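/- For every n ≥ 2, the Garside element Δ n of the braid group B n is a palindrome, rev (Δ n) = Δ n, but Δ n is not pure (π (Δ n) ≠ 1) and consequently there is no v ∈ B n with Δ n = v * rev v. -/

import Mathlib

/-- The braid relators on `n` strands: `σᵢσⱼσᵢ = σⱼσᵢσⱼ` when `|i−j| = 1` and
`σᵢσⱼ = σⱼσᵢ` when `|i−j| ≥ 2`. -/
def braidRels (n : ℕ) : Set (FreeGroup (Fin (n - 1))) :=
  { r | ∃ i j : Fin (n - 1),
      ((i : ℕ) + 1 = (j : ℕ) ∧
        r = (FreeGroup.of i * FreeGroup.of j * FreeGroup.of i) *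
            (FreeGroup.of j * FreeGroup.of i * FreeGroup.of j)⁻¹) ∨
      ((i : ℕ) + 2 ≤ (j : ℕ) ∧
        r = (FreeGroup.of i * FreeGroup.of j) * (FreeGroup.of j * FreeGroup.of i)⁻¹) }

/-- The braid group on `n` strands, as a presented group on `n - 1` generators. -/
def BraidGroup (n : ℕ) : Type := PresentedGroup (braidRels n)

instance (n : ℕ) : Group (BraidGroup n) := QuotientGroup.Quotient.group _

/-- The Artin generator `σ i` of the braid group (here `i : Fin (n-1)` corresponds to the
classical generator `σ_{i+1}`). -/
def braidGen {n : ℕ} (i : Fin (n - 1)) : BraidGroup n := PresentedGroup.of i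

/-- `braidGen' n k` is `σ_{k+1}` for `k < n - 1` and `1` otherwise. -/
def braidGen' (n : ℕ) (k : ℕ) : BraidGroup n :=
  if h : k < n - 1 then braidGen ⟨k, h⟩ else 1

/-- `braidAsc n m = σ₁ σ₂ ⋯ σ_m`. -/
def braidAsc (n m : ℕ) : BraidGroup n := ((List.range m).map (braidGen' n)).prod

/-- The Garside element `Δ n = (σ₁ ⋯ σ_{n-1}) (σ₁ ⋯ σ_{n-2}) ⋯ (σ₁ σ₂) (σ₁)`,
the closed form of the recursion `Δ 2 = σ₁`, `Δ n = σ₁ σ₂ ⋯ σ_{n-1} * Δ (n-1)`. -/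
def garside (n : ℕ) : BraidGroup n :=
  ((List.range (n - 1)).map (fun j => braidAsc n (n - 1 - j))).prod

theorem braidGen'_commute (n : ℕ) {i j : ℕ} (hij : i + 2 ≤ j) :
    Commute (braidGen' n i) (braidGen' n j) := by
  unfold braidGen'
  split_ifs with hi hj
  · have h : PresentedGroup.mk (braidRels n)
        ((FreeGroup.of ⟨i, hi⟩ * FreeGroup.of ⟨j, hj⟩) *
          (FreeGroup.of ⟨j, hj⟩ * FreeGroup.of ⟨i, hi⟩)⁻¹) = 1 :=
      PresentedGroup.one_of_mem ⟨⟨i, hi⟩, ⟨j, hj⟩, Or.inr ⟨hij, rfl⟩⟩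
    rw [map_mul, map_inv, mul_inv_eq_one, map_mul, map_mul] at h
    exact h
  · exact Commute.one_right _
  · exact Commute.one_left _
  · exact Commute.one_left _

theorem braidAsc_succ (n m : ℕ) : braidAsc n (m + 1) = braidAsc n m * braidGen' n m := by
  simp [braidAsc, List.range_succ]

theorem braidGen'_commute_braidAsc (n : ℕ) {m k : ℕ} (h : m + 1 ≤ k) :
    Commute (braidGen' n k) (braidAsc n m) := by
  induction m with
  | zero => exact Commute.one_right _
  | succ m ih =>
    rw [braidAsc_succ]
    exact (ih (by omega)).mul_right (braidGen'_commute n h).symm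

/-- The Garside element of the first `m + 1` strands, viewed in the braid group on `n` strands. -/
def partialGarside (n m : ℕ) : BraidGroup n :=
  ((List.range m).map (fun j => braidAsc n (m - j))).prod

theorem partialGarside_zero (n : ℕ) : partialGarside n 0 = 1 := rfl

theorem partialGarside_succ (n m : ℕ) :
    partialGarside n (m + 1) = braidAsc n (m + 1) * partialGarside n m := by
  simp [partialGarside, List.range_succ_eq_map, Function.comp_def]

theorem garside_eq_partialGarside (n : ℕ) : garside n = partialGarside n (n - 1) := rfl

theorem braidGen'_commute_partialGarside (n : ℕ) {m k : ℕ} (h : m + 1 ≤ k) :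
    Commute (braidGen' n k) (partialGarside n m) := by
  induction m with
  | zero => exact Commute.one_right _
  | succ m ih =>
    rw [partialGarside_succ]
    exact (braidGen'_commute_braidAsc n h).mul_right (ih (by omega))

theorem BraidGroup.closure_range_braidGen (n : ℕ) :
    Subgroup.closure (Set.range (braidGen (n := n))) = ⊤ :=
  PresentedGroup.closure_range_of (braidRels n)

section Reversal

variable {n : ℕ} {rev : BraidGroup n → BraidGroup n}

theorem rev_one_of_antihom (hmul : ∀ x y, rev (x * y) = rev y * rev x) : rev 1 = 1 := by
  have h := hmul 1 1
  rwa [mul_one, left_eq_mul] at h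

theorem rev_braidGen' (hmul : ∀ x y, rev (x * y) = rev y * rev x)
    (hgen : ∀ i : Fin (n - 1), rev (braidGen i) = braidGen i) (k : ℕ) :
    rev (braidGen' n k) = braidGen' n k := by
  unfold braidGen'
  split_ifs
  · exact hgen _
  · exact rev_one_of_antihom hmul

theorem partialGarside_succ_eq_mul_rev (hmul : ∀ x y, rev (x * y) = rev y * rev x)
    (hgen : ∀ i : Fin (n - 1), rev (braidGen i) = braidGen i) (m : ℕ) :
    partialGarside n (m + 1) = partialGarside n m * rev (braidAsc n (m + 1)) := by
  induction m with
  | zero =>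
    have h0 : braidAsc n 0 = 1 := rfl
    simp [partialGarside_succ, partialGarside_zero, braidAsc_succ, h0, rev_braidGen' hmul hgen]
  | succ m ih =>
    calc partialGarside n (m + 1 + 1)
        = braidAsc n (m + 1) * (braidGen' n (m + 1) * partialGarside n m) *
            rev (braidAsc n (m + 1)) := by
          rw [partialGarside_succ, ih, braidAsc_succ n (m + 1)]
          simp only [mul_assoc]
      _ = partialGarside n (m + 1) * rev (braidAsc n (m + 1 + 1)) := by
          rw [(braidGen'_commute_partialGarside n le_rfl).eq, braidAsc_succ n (m + 1), hmul,
            rev_braidGen' hmul hgen, partialGarside_succ n m]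
          simp only [mul_assoc]

theorem rev_partialGarside (hmul : ∀ x y, rev (x * y) = rev y * rev x)
    (hgen : ∀ i : Fin (n - 1), rev (braidGen i) = braidGen i) (m : ℕ) :
    rev (partialGarside n m) = partialGarside n m := by
  induction m with
  | zero => exact rev_one_of_antihom hmul
  | succ m ih =>
    rw [partialGarside_succ, hmul, ih, ← partialGarside_succ_eq_mul_rev hmul hgen,
      partialGarside_succ]

/-- A homomorphism sending the generators to involutions turns reversal into inversion. -/
theorem map_rev_eq_inv {G : Type*} [Group G] (hmul : ∀ x y, rev (x * y) = rev y * rev x)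
    (hgen : ∀ i : Fin (n - 1), rev (braidGen i) = braidGen i) (f : BraidGroup n →* G)
    (hf : ∀ i : Fin (n - 1), (f (braidGen i))⁻¹ = f (braidGen i)) (v : BraidGroup n) :
    f (rev v) = (f v)⁻¹ := by
  have hv : v ∈ Subgroup.closure (Set.range (braidGen (n := n))) := by
    rw [BraidGroup.closure_range_braidGen]
    exact Subgroup.mem_top v
  induction hv using Subgroup.closure_induction with
  | mem x hx =>
    obtain ⟨i, rfl⟩ := hx
    rw [hgen, hf]
  | one => rw [rev_one_of_antihom hmul, map_one, inv_one]
  | mul x y _ _ hx hy => rw [hmul, map_mul, map_mul, hx, hy, mul_inv_rev]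
  | inv x _ hx =>
    have h : rev x⁻¹ * rev x = 1 := by
      rw [← hmul, mul_inv_cancel, rev_one_of_antihom hmul]
    rw [eq_inv_of_mul_eq_one_left h, map_inv, map_inv, hx]

end Reversal

section Projection

variable {n : ℕ} {π : BraidGroup n →* Equiv.Perm (Fin n)}

theorem map_braidAsc_apply_of_lt
    (hπ : ∀ i : Fin (n - 1), π (braidGen i) =
      Equiv.swap (⟨(i : ℕ), by omega⟩ : Fin n) (⟨(i : ℕ) + 1, by omega⟩ : Fin n))
    (m : ℕ) (k : Fin n) (hk : m < k) : π (braidAsc n m) k = k := by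
  induction m with
  | zero => simp [braidAsc]
  | succ m ih =>
    have hm : m < n - 1 := by omega
    rw [braidAsc_succ, map_mul, Equiv.Perm.mul_apply, braidGen', dif_pos hm, hπ,
      Equiv.swap_apply_of_ne_of_ne (by simp [Fin.ext_iff]; omega) (by simp [Fin.ext_iff]; omega),
      ih (by omega)]

theorem map_braidAsc_apply_self
    (hπ : ∀ i : Fin (n - 1), π (braidGen i) =
      Equiv.swap (⟨(i : ℕ), by omega⟩ : Fin n) (⟨(i : ℕ) + 1, by omega⟩ : Fin n))
    (m : ℕ) (hm : m < n) : π (braidAsc n m) ⟨m, hm⟩ = ⟨0, by omega⟩ := by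
  induction m with
  | zero => simp [braidAsc]
  | succ m ih =>
    have hm' : m < n - 1 := by omega
    rw [braidAsc_succ, map_mul, Equiv.Perm.mul_apply, braidGen', dif_pos hm', hπ,
      Equiv.swap_apply_right, ih]

theorem map_partialGarside_apply_of_lt
    (hπ : ∀ i : Fin (n - 1), π (braidGen i) =
      Equiv.swap (⟨(i : ℕ), by omega⟩ : Fin n) (⟨(i : ℕ) + 1, by omega⟩ : Fin n))
    (m : ℕ) (k : Fin n) (hk : m < k) : π (partialGarside n m) k = k := by
  induction m with
  | zero => simp [partialGarside_zero]
  | succ m ih =>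
    rw [partialGarside_succ, map_mul, Equiv.Perm.mul_apply, ih (by omega),
      map_braidAsc_apply_of_lt hπ _ _ hk]

theorem map_garside_ne_one (hn : 2 ≤ n)
    (hπ : ∀ i : Fin (n - 1), π (braidGen i) =
      Equiv.swap (⟨(i : ℕ), by omega⟩ : Fin n) (⟨(i : ℕ) + 1, by omega⟩ : Fin n)) :
    π (garside n) ≠ 1 := by
  obtain ⟨m, rfl⟩ := Nat.exists_eq_add_of_le' hn
  intro h
  have hlast := congrArg (fun f => f ⟨m + 1, by omega⟩) h
  rw [garside_eq_partialGarside, Nat.add_sub_assoc (by omega), partialGarside_succ] at hlast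
  simp only [map_mul, Equiv.Perm.mul_apply, Equiv.Perm.one_apply] at hlast
  rw [map_partialGarside_apply_of_lt hπ m _ (Nat.lt_succ_self m),
    map_braidAsc_apply_self hπ] at hlast
  simp [Fin.ext_iff] at hlast

end Projection

/-- For every `n ≥ 2`, the Garside element `Δₙ` of `B n` is a palindrome
(`rev Δₙ = Δₙ`) but is not pure (`π Δₙ ≠ 1`), and consequently `Δₙ` is not of the form
`v * rev v`. -/
theorem garside_palindrome_not_pure
    (n : ℕ) (hn : 2 ≤ n)
    (rev : BraidGroup n → BraidGroup n)
    (hmul : ∀ x y, rev (x * y) = rev y * rev x)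
    (hinv : ∀ x, rev (rev x) = x)
    (hgen : ∀ i : Fin (n - 1), rev (braidGen i) = braidGen i)
    (π : BraidGroup n →* Equiv.Perm (Fin n))
    (hπ : ∀ i : Fin (n - 1),
      π (braidGen i) =
        Equiv.swap (⟨(i : ℕ), by have := i.isLt; omega⟩ : Fin n)
          (⟨(i : ℕ) + 1, by have := i.isLt; omega⟩ : Fin n)) :
    rev (garside n) = garside n ∧ π (garside n) ≠ 1 ∧
      ¬ ∃ v : BraidGroup n, garside n = v * rev v := by
  have hpure := map_garside_ne_one hn hπ
  refine ⟨rev_partialGarside hmul hgen (n - 1), hpure, ?_⟩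
  rintro ⟨v, hv⟩
  have hinvol : ∀ i : Fin (n - 1), (π (braidGen i))⁻¹ = π (braidGen i) := fun i => by
    rw [hπ, Equiv.swap_inv]
  exact hpure (by rw [hv, map_mul, map_rev_eq_inv hmul hgen π hinvol, mul_inv_cancel])
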